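/- Let A be a J-algebra and a, b ∈ A with a˘;a ≤ 1', b˘;b ≤ 1', 1 = a˘;b, and (a;a˘)·(b;b˘) ≤ 1'. Define x∇y = (x;a˘)·(y;b˘). Then the fork algebra axioms hold: (F1) x∇y = (x;(1'∇1))·(y;(1∇1')) for all x, y; (F2) (u;v˘)·(x;y˘) = (u∇x);((v∇y)˘) for all u, v, x, y; (F3) ((1'∇1)˘)∇((1∇1')˘) ≤ 1'. -/

import Mathlib

/-- A J-algebra: an algebra (A, ·, 0, 1, ;, ˘, 1') satisfying Jónsson's axioms. -/
structure JAlgebra (A : Type*) where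
  meet : A → A → A        -- Boolean product ·
  comp : A → A → A        -- relative product ;
  conv : A → A            -- converse ˘
  zero : A                -- 0
  one : A                 -- 1
  ident : A               -- 1'
  massoc : ∀ x y z, meet x (meet y z) = meet (meet x y) z
  mcomm : ∀ x y, meet x y = meet y x
  midem : ∀ x, meet x x = x
  cassoc : ∀ x y z, comp x (comp y z) = comp (comp x y) z
  cid : ∀ x, comp x ident = x
  semidist : ∀ x y z, comp (meet x y) z = meet (comp (meet x y) z) (comp y z)
  convconv : ∀ x, conv (conv x) = x
  convcomp : ∀ x y, conv (comp x y) = comp (conv y) (conv x)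
  convmeet : ∀ x y, conv (meet x y) = meet (conv x) (conv y)
  rot : ∀ x y z, meet (comp x y) z =
    meet (comp (meet (comp z (conv y)) x) (meet y (comp (conv x) z))) z
  zbot : ∀ x, meet zero x = zero
  otop : ∀ x, meet x one = x
  comp_zero : ∀ x, comp x zero = zero

/-- x ≤ y iff x·y = x. -/
def JAlgebra.le {A : Type*} (J : JAlgebra A) (x y : A) : Prop := J.meet x y = x

/-- x is functional iff x˘;x ≤ 1'. -/
def JAlgebra.Functional {A : Type*} (J : JAlgebra A) (x : A) : Prop :=
  J.le (J.comp (J.conv x) x) J.ident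

/-- x is permutational iff x;x˘ = 1' = x˘;x. -/
def JAlgebra.Permutational {A : Type*} (J : JAlgebra A) (x : A) : Prop :=
  J.comp x (J.conv x) = J.ident ∧ J.comp (J.conv x) x = J.ident

/-- The fork operation x∇y = (x;a˘)·(y;b˘) with parameters a, b. -/
def JAlgebra.fork {A : Type*} (J : JAlgebra A) (a b x y : A) : A :=
  J.meet (J.comp x (J.conv a)) (J.comp y (J.conv b))

namespace JAlgebra

variable {A : Type*} (J : JAlgebra A)

theorem le_refl (x : A) : J.le x x := J.midem x

variable {J}

theorem le_trans {x y z : A} (h : J.le x y) (k : J.le y z) : J.le x z := by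
  unfold le at *
  rw [← h, ← J.massoc, k]

theorem le_antisymm {x y : A} (h : J.le x y) (k : J.le y x) : x = y := by
  unfold le at *
  rw [← h, J.mcomm, k]

theorem meet_le_left {x y : A} : J.le (J.meet x y) x := by
  unfold le
  rw [J.mcomm, J.massoc, J.midem]

theorem meet_le_right {x y : A} : J.le (J.meet x y) y := by
  unfold le
  rw [← J.massoc, J.midem]

theorem le_meet {x y z : A} (h : J.le x y) (k : J.le x z) : J.le x (J.meet y z) := by
  unfold le at *
  rw [J.massoc, h, k]

theorem le_one (x : A) : J.le x J.one := J.otop x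

theorem meet_mono {x y z w : A} (h : J.le x y) (k : J.le z w) :
    J.le (J.meet x z) (J.meet y w) :=
  le_meet (le_trans meet_le_left h) (le_trans meet_le_right k)

theorem conv_mono {x y : A} (h : J.le x y) : J.le (J.conv x) (J.conv y) := by
  unfold le at *
  rw [← J.convmeet, h]

theorem comp_mono_left {x y : A} (z : A) (h : J.le x y) : J.le (J.comp x z) (J.comp y z) := by
  have := J.semidist x y z
  unfold le at *
  rw [h] at this
  exact this.symm

theorem comp_mono {x y z w : A} (h : J.le x y) (k : J.le z w) :
    J.le (J.comp x z) (J.comp y w) := by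
  refine le_trans (comp_mono_left z h) ?_
  have := conv_mono (comp_mono_left (J.conv y) (conv_mono k))
  simpa only [J.convcomp, J.convconv] using this

variable (J)

theorem conv_ident : J.conv J.ident = J.ident := by
  have h := J.convcomp (J.conv J.ident) J.ident
  rw [J.cid, J.convconv, J.cid] at h
  exact h.symm

theorem ident_comp (x : A) : J.comp J.ident x = x := by
  have h := J.convcomp (J.conv x) J.ident
  rw [J.cid, J.convconv, J.conv_ident] at h
  exact h.symm

variable {J}

/-- The modular law in the form of an upper bound for `x;y · z`. -/
theorem le_comp_of_le {c x y z : A} (h : J.le c (J.comp x y)) (k : J.le c z) :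
    J.le c (J.comp (J.meet (J.comp z (J.conv y)) x) (J.meet y (J.comp (J.conv x) z))) := by
  refine le_trans (le_meet h k) ?_
  rw [J.rot]
  exact meet_le_left

theorem le_comp_self {e : A} (h : J.le e J.ident) : J.le e (J.comp e e) := by
  have h₁ : J.le e (J.comp e J.ident) := by rw [J.cid]; exact J.le_refl e
  have h₂ : J.le (J.conv e) J.ident := by
    have := conv_mono h
    rwa [J.conv_ident] at this
  refine le_trans (le_comp_of_le h₁ (J.le_refl e)) (comp_mono meet_le_right ?_)
  refine le_trans meet_le_right (le_trans (comp_mono_left e h₂) ?_)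
  rw [J.ident_comp]
  exact J.le_refl e

/-- Every element is absorbed on the left by its domain. -/
theorem le_domain_comp (x : A) :
    J.le x (J.comp (J.meet J.ident (J.comp x (J.conv x))) x) := by
  have h : J.le x (J.comp J.ident x) := by rw [J.ident_comp]; exact J.le_refl x
  refine le_trans (le_comp_of_le h (J.le_refl x)) (comp_mono ?_ meet_le_left)
  rw [J.mcomm]
  exact J.le_refl _

/-- Every element is absorbed on the right by its range. -/
theorem le_comp_range (x : A) :
    J.le x (J.comp x (J.meet J.ident (J.comp (J.conv x) x))) := by
  have h : J.le x (J.comp x J.ident) := by rw [J.cid]; exact J.le_refl x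
  exact le_trans (le_comp_of_le h (J.le_refl x)) (comp_mono meet_le_right (J.le_refl _))

/-- A subidentity below `x;y˘` is below the domain of `x·y`. -/
theorem le_meet_comp_conv {e x y : A} (he : J.le e J.ident)
    (h : J.le e (J.comp x (J.conv y))) :
    J.le e (J.comp (J.meet x y) (J.conv (J.meet x y))) := by
  refine le_trans (le_comp_of_le h he) ?_
  rw [J.convconv, J.ident_comp, J.cid, ← J.convmeet, J.mcomm y x]
  exact J.le_refl _

theorem functional_comp_le {a x y : A} (ha : J.Functional a) :
    J.le (J.comp (J.comp x (J.conv a)) (J.comp a y)) (J.comp x y) := by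
  have h := comp_mono (J.le_refl x) (comp_mono_left y ha)
  simpa only [J.ident_comp, J.cassoc] using h

/-- A subidentity contained in the domains of `m` and `n` is contained in the domain of the
fork of `m` and `n`. -/
theorem le_fork_comp_conv {a b e m n : A} (hQ : J.one = J.comp (J.conv a) b)
    (he : J.le e J.ident) (hm : J.le e (J.comp m (J.conv m)))
    (hn : J.le e (J.comp n (J.conv n))) :
    J.le e (J.comp (J.fork a b m n) (J.conv (J.fork a b m n))) := by
  refine le_meet_comp_conv he (le_trans (le_comp_self he) (le_trans (comp_mono hm hn) ?_))
  have h := comp_mono (J.le_refl m)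
    (comp_mono_left (J.conv n) (J.le_one (J.comp (J.conv m) n)))
  rw [hQ] at h
  simpa only [J.convcomp, J.convconv, J.cassoc] using h

theorem fork_mono {a b x y z w : A} (h : J.le x y) (k : J.le z w) :
    J.le (J.fork a b x z) (J.fork a b y w) :=
  meet_mono (comp_mono_left _ h) (comp_mono_left _ k)

/-- Composition with the converse of a functional element cancels inside a fork. -/
theorem conv_comp_fork_le {a b f x y : A} (hf : J.Functional f) :
    J.le (J.comp (J.conv f) (J.fork a b (J.comp f x) (J.comp f y))) (J.fork a b x y) := by
  have h (z c : A) : J.le (J.comp (J.conv f) (J.comp (J.comp f z) c)) (J.comp z c) := by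
    have := comp_mono_left (J.comp z c) hf
    rwa [J.ident_comp, ← J.cassoc, J.cassoc f] at this
  exact le_meet (le_trans (comp_mono (J.le_refl _) meet_le_left) (h _ _))
    (le_trans (comp_mono (J.le_refl _) meet_le_right) (h _ _))

theorem Functional.of_le {f g : A} (hg : J.Functional g) (h : J.le f g) : J.Functional f :=
  le_trans (comp_mono (conv_mono h) h) hg

/-- The inequality behind the second fork axiom; the first quasiprojection `a` and the
restriction `b · a;w` of the second one tabulate `w = u;v˘ · x;y˘`. -/
theorem meet_le_fork_comp_conv_fork {a b : A} (ha : J.Functional a) (hb : J.Functional b)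
    (hQ : J.one = J.comp (J.conv a) b) (u v x y : A) :
    J.le (J.meet (J.comp u (J.conv v)) (J.comp x (J.conv y)))
      (J.comp (J.fork a b u x) (J.conv (J.fork a b v y))) := by
  set w := J.meet (J.comp u (J.conv v)) (J.comp x (J.conv y))
  obtain ⟨g, hg⟩ : ∃ g, g = J.meet b (J.comp a w) := ⟨_, rfl⟩
  have hgb : J.Functional g := hb.of_le (by rw [hg]; exact meet_le_left)
  have hwg : J.le w (J.comp (J.conv a) g) := by
    have h : J.le w (J.comp (J.conv a) b) := by rw [← hQ]; exact J.le_one w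
    have h' := le_comp_of_le h (J.le_refl w)
    rw [J.convconv, ← hg] at h'
    exact le_trans h' (comp_mono_left _ meet_le_right)
  have hgw : J.le (J.comp (J.conv a) g) w := by
    have h : J.le g (J.comp a w) := by rw [hg]; exact meet_le_right
    refine le_trans (comp_mono (J.le_refl _) h) ?_
    have := comp_mono_left w ha
    rwa [J.ident_comp, ← J.cassoc] at this
  set d := J.comp (J.meet J.ident (J.comp a (J.conv a)))
    (J.meet J.ident (J.comp g (J.conv g))) with hd
  have hd₁ : J.le d J.ident := by
    have := comp_mono (J := J) (meet_le_left (x := J.ident) (y := J.comp a (J.conv a)))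
      (meet_le_left (x := J.ident) (y := J.comp g (J.conv g)))
    rwa [J.cid] at this
  have hd₂ : J.le d (J.comp a (J.comp w (J.conv g))) := by
    have h := comp_mono (J := J) (meet_le_right (x := J.ident) (y := J.comp a (J.conv a)))
      (meet_le_right (x := J.ident) (y := J.comp g (J.conv g)))
    refine le_trans h ?_
    have := comp_mono (J.le_refl a) (comp_mono_left (J.conv g) hgw)
    simpa only [J.cassoc] using this
  have hwd : J.le w (J.comp (J.conv a) (J.comp d g)) := by
    refine le_trans hwg ?_
    have := comp_mono (J := J) (le_comp_range (J.conv a)) (le_domain_comp g)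
    simpa only [J.convconv, hd, J.cassoc] using this
  have hdom (s t : A) (hst : J.le w (J.comp s (J.conv t))) :
      J.le d (J.comp (J.meet (J.comp a s) (J.comp g t))
        (J.conv (J.meet (J.comp a s) (J.comp g t)))) := by
    refine le_meet_comp_conv hd₁ (le_trans hd₂ ?_)
    have := comp_mono (J.le_refl a) (comp_mono_left (J.conv g) hst)
    simpa only [J.convcomp, J.cassoc] using this
  have hk := le_fork_comp_conv hQ hd₁ (hdom u v meet_le_left) (hdom x y meet_le_right)
  set k := J.fork a b (J.meet (J.comp a u) (J.comp g v)) (J.meet (J.comp a x) (J.comp g y))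
  have hak : J.le (J.comp (J.conv a) k) (J.fork a b u x) :=
    le_trans (comp_mono (J.le_refl _) (fork_mono meet_le_left meet_le_left))
      (conv_comp_fork_le ha)
  have hgk : J.le (J.comp (J.conv g) k) (J.fork a b v y) :=
    le_trans (comp_mono (J.le_refl _) (fork_mono meet_le_right meet_le_right))
      (conv_comp_fork_le hgb)
  have h := comp_mono hak (conv_mono hgk)
  rw [J.convcomp, J.convconv] at h
  refine le_trans hwd (le_trans (comp_mono (J.le_refl _) (comp_mono_left g hk)) ?_)
  simpa only [J.cassoc] using h

end JAlgebra

open JAlgebra in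
/-- If a, b are conjugated quasiprojections (Q) satisfying the Unicity
Condition (U), then ∇ defined by x∇y = (x;a˘)·(y;b˘) satisfies the fork
algebra axioms F1, F2, F3. -/
theorem fork_axioms {A : Type*} (J : JAlgebra A) (a b : A)
    (ha : J.le (J.comp (J.conv a) a) J.ident)
    (hb : J.le (J.comp (J.conv b) b) J.ident)
    (hQ : J.one = J.comp (J.conv a) b)
    (hU : J.le (J.meet (J.comp a (J.conv a)) (J.comp b (J.conv b))) J.ident) :
    (∀ x y : A, J.fork a b x y =
      J.meet (J.comp x (J.fork a b J.ident J.one)) (J.comp y (J.fork a b J.one J.ident))) ∧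
    (∀ u v x y : A,
      J.meet (J.comp u (J.conv v)) (J.comp x (J.conv y)) =
        J.comp (J.fork a b u x) (J.conv (J.fork a b v y))) ∧
    J.le (J.fork a b (J.conv (J.fork a b J.ident J.one))
                     (J.conv (J.fork a b J.one J.ident))) J.ident := by
  refine ⟨fun x y => le_antisymm (J := J) ?_ ?_, fun u v x y => le_antisymm (J := J) ?_ ?_, ?_⟩
  · have h₁ := le_comp_of_le (J := J) (meet_le_left (x := J.comp x (J.conv a))
      (y := J.comp y (J.conv b))) (meet_le_right (x := J.comp x (J.conv a)))
    have h₂ := le_comp_of_le (J := J) (meet_le_right (x := J.comp x (J.conv a))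
      (y := J.comp y (J.conv b))) (meet_le_left (x := J.comp x (J.conv a)))
    refine le_meet (le_trans h₁ (comp_mono meet_le_right ?_))
      (le_trans h₂ (comp_mono meet_le_right ?_))
    · unfold fork
      rw [J.ident_comp, J.cassoc]
      exact meet_mono (J.le_refl _) (comp_mono_left _ (J.le_one _))
    · unfold fork
      rw [J.ident_comp, J.cassoc, J.mcomm]
      exact meet_mono (comp_mono_left _ (J.le_one _)) (J.le_refl _)
  · unfold fork
    rw [J.ident_comp, J.ident_comp]
    exact meet_mono (comp_mono (J.le_refl _) meet_le_left)
      (comp_mono (J.le_refl _) meet_le_right)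
  · exact meet_le_fork_comp_conv_fork ha hb hQ u v x y
  · unfold fork
    rw [J.convmeet]
    simp only [J.convcomp, J.convconv]
    exact le_meet
      (le_trans (comp_mono meet_le_left meet_le_left) (functional_comp_le ha))
      (le_trans (comp_mono meet_le_right meet_le_right) (functional_comp_le hb))
  · refine le_trans (meet_mono (comp_mono_left _ ?_) (comp_mono_left _ ?_)) hU
    · have h : J.le (J.fork a b J.ident J.one) (J.conv a) := by
        unfold fork
        rw [J.ident_comp]
        exact meet_le_left
      simpa only [J.convconv] using conv_mono h
    · have h : J.le (J.fork a b J.one J.ident) (J.conv b) := by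
        unfold fork
        rw [J.ident_comp]
        exact meet_le_right
      simpa only [J.convconv] using conv_mono h
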